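/- arXiv:2110.11224 — 4 statements merged into one kernel-verified Lean document; each statement's English description precedes it below -/
import Mathlib

section
/- Let φ : [-1,1] → ℝ be a C² function with inf_{x∈[-1,1]} |φ''(x)| > 0. Then there exists a constant C > 0, depending only on φ, such that for every positive integer N and every finite sequence of complex numbers (a_n)_{n=-N}^{N}, one has ‖∑_{n=-N}^{N} a_n e(n x + n² φ(x))‖_{L²(-1,1)} ≤ C (∑_{n=-N}^{N} |a_n|²)^{1/2}. -/
open MeasureTheory

/-- `e z = e^{2πiz}`. -/
noncomputable def e (t : ℝ) : ℂ := Complex.exp (2 * Real.pi * Complex.I * t)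

theorem norm_integral_exp_I_mul_le {a b lam : ℝ} (hab : a ≤ b) (hlam : 0 < lam)
    {f f' f'' : ℝ → ℝ} (hf : ContinuousOn f (Set.Icc a b)) (hf' : ContinuousOn f' (Set.Icc a b))
    (hf'' : ContinuousOn f'' (Set.Icc a b))
    (hd : ∀ x ∈ Set.Ioo a b, HasDerivAt f (f' x) x)
    (hd' : ∀ x ∈ Set.Ioo a b, HasDerivAt f' (f'' x) x)
    (hlow : ∀ x ∈ Set.Icc a b, lam ≤ f'' x) :
    ‖∫ x in a..b, Complex.exp (Complex.I * f x)‖ ≤ 8 / √lam := by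
  have hs : 0 < √lam := Real.sqrt_pos.2 hlam
  have hsq : √lam ^ 2 = lam := Real.sq_sqrt hlam.le
  have hpos : ∀ x, 0 < f' x ^ 2 + lam := fun x => by positivity
  set g : ℝ → ℝ := fun x => f' x / (f' x ^ 2 + lam) with hg
  set g' : ℝ → ℝ := fun x => f'' x * (lam - f' x ^ 2) / (f' x ^ 2 + lam) ^ 2 with hg'
  set k : ℝ → ℝ := fun x => lam / (f' x ^ 2 + lam) with hk
  set R : ℝ → ℂ := fun x => Complex.exp (Complex.I * f x) * (g' x - Complex.I * k x) with hR
  have hgc : ContinuousOn g (Set.Icc a b) :=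
    hf'.div (by fun_prop) fun x _ => (hpos x).ne'
  have hg'c : ContinuousOn g' (Set.Icc a b) :=
    ContinuousOn.div (by fun_prop) (by fun_prop) fun x _ => (pow_pos (hpos x) 2).ne'
  have hkc : ContinuousOn k (Set.Icc a b) :=
    ContinuousOn.div (by fun_prop) (by fun_prop) fun x _ => (hpos x).ne'
  have hRc : ContinuousOn R (Set.Icc a b) := by fun_prop
  have hI : ∀ {h : ℝ → ℂ}, ContinuousOn h (Set.Icc a b) → IntervalIntegrable h volume a b :=
    fun h => ContinuousOn.intervalIntegrable_of_Icc hab h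
  have h1 : ∫ x in a..b, (Complex.I * Complex.exp (Complex.I * f x) + R x) =
      Complex.exp (Complex.I * f b) * g b - Complex.exp (Complex.I * f a) * g a := by
    refine intervalIntegral.integral_eq_sub_of_hasDerivAt_of_le hab
      (f := fun x => Complex.exp (Complex.I * f x) * g x) (by fun_prop) (fun x hx => ?_)
      (hI (by fun_prop))
    have e1 : HasDerivAt (fun x => Complex.exp (Complex.I * f x))
        (Complex.exp (Complex.I * f x) * (Complex.I * f' x)) x :=
      ((hd x hx).ofReal_comp.const_mul Complex.I).cexp
    have e2 : HasDerivAt g (g' x) x := by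
      have := (hd' x hx).div (((hd' x hx).pow 2).add_const lam) (hpos x).ne'
      refine this.congr_deriv ?_
      simp only [hg', Pi.pow_apply]
      congr 1
      push_cast
      ring
    refine (e1.mul e2.ofReal_comp).congr_deriv ?_
    have hne : ((f' x : ℂ) ^ 2 + lam) ≠ 0 := by exact_mod_cast (hpos x).ne'
    simp only [hR, hg, hk]
    push_cast
    field_simp
    ring
  have h2 : ‖∫ x in a..b, R x‖ ≤ 2 * Real.pi / √lam := by
    have hle : ∀ x ∈ Set.Icc a b, ‖R x‖ ≤ 2 * (f'' x / (f' x ^ 2 + lam)) := by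
      intro x hx
      have h := hlow x hx
      have hp := hpos x
      rw [hR]
      simp only [norm_mul, mul_comm Complex.I, Complex.norm_exp_ofReal_mul_I, one_mul]
      refine (norm_sub_le _ _).trans ?_
      have b1 : |g' x| ≤ f'' x / (f' x ^ 2 + lam) := by
        rw [hg', abs_div, abs_mul, abs_of_pos (pow_pos hp 2), abs_of_pos (hlam.trans_le h),
          div_le_div_iff₀ (pow_pos hp 2) hp]
        have : |lam - f' x ^ 2| ≤ f' x ^ 2 + lam := by
          rw [abs_le]; constructor <;> nlinarith [sq_nonneg (f' x)]
        have h0 : 0 ≤ f'' x * (f' x ^ 2 + lam) := mul_nonneg (hlam.le.trans h) hp.le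
        nlinarith [mul_le_mul_of_nonneg_left this h0]
      have b2 : |k x| ≤ f'' x / (f' x ^ 2 + lam) := by
        rw [hk, abs_of_pos (div_pos hlam hp)]
        gcongr
      simp only [norm_mul, Complex.norm_I, Complex.norm_real, Real.norm_eq_abs, mul_one]
      linarith
    have hqc : ContinuousOn (fun x => 2 * (f'' x / (f' x ^ 2 + lam))) (Set.Icc a b) :=
      (ContinuousOn.div hf'' (by fun_prop) fun x _ => (hpos x).ne').const_mul 2
    have h3 : ∫ x in a..b, 2 * (f'' x / (f' x ^ 2 + lam)) =
        2 / √lam * Real.arctan (f' b / √lam) - 2 / √lam * Real.arctan (f' a / √lam) := by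
      refine intervalIntegral.integral_eq_sub_of_hasDerivAt_of_le hab
        (f := fun x => 2 / √lam * Real.arctan (f' x / √lam)) (by fun_prop) (fun x hx => ?_)
        (hqc.intervalIntegrable_of_Icc hab)
      refine ((((hd' x hx).div_const (√lam)).arctan).const_mul (2 / √lam)).congr_deriv ?_
      have := (hpos x).ne'
      rw [← hsq] at this ⊢
      have h5 : 1 + (f' x / √lam) ^ 2 = (f' x ^ 2 + √lam ^ 2) / √lam ^ 2 := by
        field_simp
        ring
      rw [Real.sqrt_sq hs.le, h5]
      field_simp
    refine (intervalIntegral.norm_integral_le_of_norm_le hab (g := fun x =>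
      2 * (f'' x / (f' x ^ 2 + lam))) ?_ (hqc.intervalIntegrable_of_Icc hab)).trans ?_
    · exact Filter.Eventually.of_forall fun x hx => hle x (Set.Ioc_subset_Icc_self hx)
    · rw [h3, ← mul_sub, mul_div_right_comm]
      gcongr
      linarith [Real.arctan_lt_pi_div_two (f' b / √lam),
        Real.neg_pi_div_two_lt_arctan (f' a / √lam)]
  have hgb : ∀ x, ‖Complex.exp (Complex.I * f x) * g x‖ ≤ 1 / (2 * √lam) := by
    intro x
    rw [norm_mul, mul_comm Complex.I, Complex.norm_exp_ofReal_mul_I, one_mul, Complex.norm_real,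
      hg, Real.norm_eq_abs, abs_div, abs_of_pos (hpos x), div_le_div_iff₀ (hpos x) (by positivity)]
    nlinarith [sq_nonneg (|f' x| - √lam), sq_abs (f' x)]
  rw [intervalIntegral.integral_add (hI (by fun_prop)) (hI hRc),
    intervalIntegral.integral_const_mul] at h1
  have h4 : ‖∫ x in a..b, Complex.exp (Complex.I * f x)‖ =
      ‖Complex.exp (Complex.I * f b) * g b - Complex.exp (Complex.I * f a) * g a
        - ∫ x in a..b, R x‖ := by
    rw [← h1, add_sub_cancel_right, norm_mul, Complex.norm_I, one_mul]
  rw [h4]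
  refine (norm_sub_le _ _).trans ((add_le_add (norm_sub_le _ _) h2).trans ?_)
  refine (add_le_add_left (add_le_add (hgb b) (hgb a)) _).trans ?_
  rw [show 1 / (2 * √lam) + 1 / (2 * √lam) + 2 * Real.pi / √lam = (1 + 2 * Real.pi) / √lam by
    field_simp; ring]
  gcongr
  linarith [Real.pi_lt_d2]

theorem sum_inv_sqrt_le (n : ℕ) : ∑ i ∈ Finset.range n, 1 / √((i : ℝ) + 1) ≤ 2 * √(n : ℝ) := by
  induction n with
  | zero => simp
  | succ n ih =>
    rw [Finset.sum_range_succ]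
    push_cast
    have hs : 0 < √((n : ℝ) + 1) := by positivity
    have h1 : √((n : ℝ) + 1) ^ 2 = n + 1 := Real.sq_sqrt (by positivity)
    have h2 : √(n : ℝ) ^ 2 = n := Real.sq_sqrt (by positivity)
    have : 1 / √((n : ℝ) + 1) ≤ 2 * √((n : ℝ) + 1) - 2 * √(n : ℝ) := by
      rw [div_le_iff₀ hs]
      nlinarith [sq_nonneg (√((n : ℝ) + 1) - √(n : ℝ))]
    linarith

theorem sum_inv_mul_sqrt_le {r : ℝ} (hr : 0 < r) (n : ℕ) :
    ∑ i ∈ Finset.range n, 1 / ((r ^ 2 + (i + 1)) * √((i : ℝ) + 1)) ≤ 4 / r := by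
  suffices h : ∑ i ∈ Finset.range n, 1 / ((r ^ 2 + (i + 1)) * √((i : ℝ) + 1)) ≤
      4 / r - 4 / (r + √(n : ℝ)) from h.trans (sub_le_self _ (by positivity))
  induction n with
  | zero => simp
  | succ n ih =>
    rw [Finset.sum_range_succ]
    push_cast
    have hs : 0 < √((n : ℝ) + 1) := by positivity
    have ht : 0 ≤ √(n : ℝ) := by positivity
    have h1 : √((n : ℝ) + 1) ^ 2 = n + 1 := Real.sq_sqrt (by positivity)
    have h2 : √(n : ℝ) ^ 2 = n := Real.sq_sqrt (by positivity)
    have hts : √(n : ℝ) ≤ √((n : ℝ) + 1) := Real.sqrt_le_sqrt (by linarith)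
    generalize √((n : ℝ) + 1) = s at *
    rw [← h1]
    generalize √(n : ℝ) = t at *
    have key : 1 / ((r ^ 2 + s ^ 2) * s) ≤ 4 / (r + t) - 4 / (r + s) := by
      have e : 4 / (r + t) - 4 / (r + s) = 4 / ((s + t) * ((r + t) * (r + s))) := by
        have : (s - t) * (s + t) = 1 := by linarith [h1, h2, mul_comm s t]
        field_simp
        linear_combination this
      rw [e, div_le_div_iff₀ (by positivity) (by positivity)]
      have q1 : (r + t) * (r + s) ≤ 2 * (r ^ 2 + s ^ 2) := by
        nlinarith [sq_nonneg (r - s), mul_le_mul_of_nonneg_left hts (by positivity : 0 ≤ r + s)]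
      have q2 : s + t ≤ 2 * s := by linarith
      have := mul_le_mul q2 q1 (by positivity) (by positivity)
      linarith
    linarith

/-- A symmetric majorant for the oscillatory integrals, on the absolute values of the
frequencies. -/
noncomputable def hilbertKernel (j k : ℕ) : ℝ :=
  if j = k then 1 else 1 / √(|(j : ℝ) - k| * (max (j : ℝ) k + 1))

theorem hilbertKernel_nonneg (j k : ℕ) : 0 ≤ hilbertKernel j k := by
  unfold hilbertKernel; split_ifs <;> positivity

theorem hilbertKernel_comm (j k : ℕ) : hilbertKernel j k = hilbertKernel k j := by
  simp only [hilbertKernel, eq_comm (a := j), abs_sub_comm (j : ℝ), max_comm (j : ℝ)]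

theorem sum_hilbertKernel_lt_le (j : ℕ) :
    ∑ k ∈ Finset.range j, hilbertKernel j k * (1 / √((k : ℝ) + 1)) ≤ 4 / √((j : ℝ) + 1) := by
  have hp : 0 < √((j : ℝ) + 1) := by positivity
  have h : ∀ k ∈ Finset.range j, hilbertKernel j k * (1 / √((k : ℝ) + 1)) ≤
      1 / ((j : ℝ) + 1) * (1 / √(((j - 1 - k : ℕ) : ℝ) + 1) + 1 / √((k : ℝ) + 1)) := by
    intro k hk
    have hkj := Finset.mem_range.1 hk
    have hkj' : (k : ℝ) + 1 ≤ j := by exact_mod_cast hkj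
    have c : ((j - 1 - k : ℕ) : ℝ) + 1 = j - k := by
      rw [Nat.sub_sub, Nat.cast_sub (by omega)]; push_cast; ring
    rw [hilbertKernel, if_neg (by omega), c, max_eq_left (by linarith), abs_of_pos (by linarith),
      Real.sqrt_mul (by linarith)]
    have hx : 0 < √((j : ℝ) - k) := Real.sqrt_pos.2 (by linarith)
    have hy : 0 < √((k : ℝ) + 1) := by positivity
    have hx2 : √((j : ℝ) - k) ^ 2 = j - k := Real.sq_sqrt (by linarith)
    have hy2 : √((k : ℝ) + 1) ^ 2 = k + 1 := Real.sq_sqrt (by positivity)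
    have hp2 : √((j : ℝ) + 1) ^ 2 = j + 1 := Real.sq_sqrt (by positivity)
    generalize √((j : ℝ) - k) = x at *
    generalize √((k : ℝ) + 1) = y at *
    generalize √((j : ℝ) + 1) = p at *
    rw [← hp2]
    have hpxy : p ≤ x + y := by
      apply le_of_sq_le_sq _ (by positivity)
      nlinarith [mul_pos hx hy]
    have e1 : 1 / (x * p) * (1 / y) = p / (p ^ 2 * (x * y)) := by field_simp
    have e2 : 1 / p ^ 2 * (1 / x + 1 / y) = (x + y) / (p ^ 2 * (x * y)) := by
      field_simp; ring
    rw [e1, e2]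
    gcongr
  refine (Finset.sum_le_sum h).trans ?_
  rw [← Finset.mul_sum, Finset.sum_add_distrib,
    Finset.sum_range_reflect (fun k : ℕ => 1 / √((k : ℝ) + 1)) j]
  have h1 := sum_inv_sqrt_le j
  have h2 : √(j : ℝ) ≤ √((j : ℝ) + 1) := Real.sqrt_le_sqrt (by linarith)
  have h3 : √((j : ℝ) + 1) ^ 2 = j + 1 := Real.sq_sqrt (by positivity)
  calc _ ≤ 1 / ((j : ℝ) + 1) * (4 * √((j : ℝ) + 1)) := by gcongr; linarith
    _ = 1 / √((j : ℝ) + 1) ^ 2 * (4 * √((j : ℝ) + 1)) := by rw [h3]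
    _ = _ := by field_simp

theorem sum_hilbertKernel_gt_le (j M : ℕ) :
    ∑ i ∈ Finset.range M, hilbertKernel j (j + 1 + i) * (1 / √(((j + 1 + i : ℕ) : ℝ) + 1)) ≤
      4 / √((j : ℝ) + 1) := by
  refine (Finset.sum_le_sum fun i _ => ?_).trans
    (sum_inv_mul_sqrt_le (r := √((j : ℝ) + 1)) (by positivity) M)
  rw [hilbertKernel, if_neg (by omega), max_eq_right (by push_cast; linarith), abs_sub_comm,
    abs_of_nonneg (by push_cast; linarith), Real.sq_sqrt (by positivity)]
  push_cast
  rw [show (j : ℝ) + 1 + i - j = i + 1 by ring, show (j : ℝ) + 1 + i + 1 = j + 1 + (i + 1) by ring,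
    Real.sqrt_mul (by positivity)]
  refine le_of_eq ?_
  have : √((j : ℝ) + 1 + (i + 1)) ^ 2 = j + 1 + (i + 1) := Real.sq_sqrt (by positivity)
  rw [← this]
  rw [Real.sqrt_sq (by positivity)]
  field_simp

theorem sum_hilbertKernel_le (j N : ℕ) :
    ∑ k ∈ Finset.range N, hilbertKernel j k * (1 / √((k : ℝ) + 1)) ≤ 9 / √((j : ℝ) + 1) := by
  have h0 : ∀ k, 0 ≤ hilbertKernel j k * (1 / √((k : ℝ) + 1)) := fun k =>
    mul_nonneg (hilbertKernel_nonneg j k) (by positivity)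
  calc _ ≤ ∑ k ∈ Finset.range (j + 1 + N), hilbertKernel j k * (1 / √((k : ℝ) + 1)) :=
        Finset.sum_le_sum_of_subset_of_nonneg (Finset.range_mono (by omega)) fun k _ _ => h0 k
    _ ≤ 4 / √((j : ℝ) + 1) + 1 / √((j : ℝ) + 1) + 4 / √((j : ℝ) + 1) := by
        rw [Finset.sum_range_add, Finset.sum_range_succ]
        refine add_le_add (add_le_add (sum_hilbertKernel_lt_le j) ?_) (sum_hilbertKernel_gt_le j N)
        simp [hilbertKernel]
    _ = _ := by ring

theorem sum_natAbs_le {F : ℕ → ℝ} (hF : ∀ k, 0 ≤ F k) (N : ℕ) :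
    ∑ m ∈ Finset.Icc (-(N : ℤ)) N, F m.natAbs ≤ 2 * ∑ k ∈ Finset.range (N + 1), F k := by
  have hmem : ∀ m ∈ Finset.Icc (-(N : ℤ)) N, m.natAbs ∈ Finset.range (N + 1) := by
    intro m hm
    rw [Finset.mem_Icc] at hm
    rw [Finset.mem_range]
    omega
  rw [← Finset.sum_fiberwise_of_maps_to hmem, Finset.mul_sum]
  refine Finset.sum_le_sum fun k _ => ?_
  rw [Finset.sum_congr rfl (g := fun _ => F k) fun m hm => by rw [(Finset.mem_filter.1 hm).2],
    Finset.sum_const, nsmul_eq_mul]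
  refine mul_le_mul_of_nonneg_right ?_ (hF k)
  have hsub : (Finset.Icc (-(N : ℤ)) N).filter (fun m => m.natAbs = k) ⊆ {(k : ℤ), -(k : ℤ)} := by
    intro m hm
    have := (Finset.mem_filter.1 hm).2
    simp only [Finset.mem_insert, Finset.mem_singleton]
    omega
  exact_mod_cast (Finset.card_le_card hsub).trans Finset.card_le_two

theorem schur_test {ι : Type*} (s : Finset ι) {K : ι → ι → ℝ} {w x : ι → ℝ} {B : ℝ}
    (hK : ∀ i j, 0 ≤ K i j) (hsymm : ∀ i j, K i j = K j i) (hw : ∀ i, 0 < w i)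
    (hB : ∀ i ∈ s, ∑ j ∈ s, K i j * w j ≤ B * w i) :
    ∑ i ∈ s, ∑ j ∈ s, K i j * (x i * x j) ≤ B * ∑ i ∈ s, x i ^ 2 := by
  have h1 : ∀ i j, K i j * (x i * x j) ≤
      (x i ^ 2 / w i * (K i j * w j) + x j ^ 2 / w j * (K j i * w i)) / 2 := by
    intro i j
    have hi := hw i
    have hj := hw j
    rw [hsymm j i]
    have : x i * x j ≤ (x i ^ 2 / w i * w j + x j ^ 2 / w j * w i) / 2 := by
      have e : (x i ^ 2 / w i * w j + x j ^ 2 / w j * w i) / 2 - x i * x j =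
          (x i * w j - x j * w i) ^ 2 / (2 * (w i * w j)) := by
        field_simp; ring
      have : 0 ≤ (x i * w j - x j * w i) ^ 2 / (2 * (w i * w j)) := by positivity
      linarith
    calc _ ≤ K i j * ((x i ^ 2 / w i * w j + x j ^ 2 / w j * w i) / 2) :=
          mul_le_mul_of_nonneg_left this (hK i j)
      _ = _ := by ring
  have h2 : ∑ i ∈ s, ∑ j ∈ s, x i ^ 2 / w i * (K i j * w j) ≤ B * ∑ i ∈ s, x i ^ 2 := by
    rw [Finset.mul_sum]
    refine Finset.sum_le_sum fun i hi => ?_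
    rw [← Finset.mul_sum]
    have := hw i
    calc _ ≤ x i ^ 2 / w i * (B * w i) :=
          mul_le_mul_of_nonneg_left (hB i hi) (by positivity)
      _ = _ := by field_simp
  calc _ ≤ ∑ i ∈ s, ∑ j ∈ s,
        (x i ^ 2 / w i * (K i j * w j) + x j ^ 2 / w j * (K j i * w i)) / 2 :=
        Finset.sum_le_sum fun i _ => Finset.sum_le_sum fun j _ => h1 i j
    _ = ∑ i ∈ s, ∑ j ∈ s, x i ^ 2 / w i * (K i j * w j) := by
        simp only [← Finset.sum_div, Finset.sum_add_distrib]
        rw [Finset.sum_comm (f := fun i j => x j ^ 2 / w j * (K j i * w i))]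
        ring
    _ ≤ _ := h2

theorem sum_hilbertKernel_natAbs_mul_le (N : ℕ) (x : ℤ → ℝ) :
    ∑ n ∈ Finset.Icc (-(N : ℤ)) N, ∑ m ∈ Finset.Icc (-(N : ℤ)) N,
      hilbertKernel n.natAbs m.natAbs * (x n * x m) ≤
      18 * ∑ n ∈ Finset.Icc (-(N : ℤ)) N, x n ^ 2 := by
  refine schur_test _ (w := fun n : ℤ => 1 / √((n.natAbs : ℝ) + 1))
    (fun _ _ => hilbertKernel_nonneg _ _) (fun _ _ => hilbertKernel_comm _ _)
    (fun _ => by positivity) fun n _ => ?_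
  refine (sum_natAbs_le (F := fun k => hilbertKernel n.natAbs k * (1 / √((k : ℝ) + 1)))
    (fun k => mul_nonneg (hilbertKernel_nonneg _ k) (by positivity)) N).trans ?_
  have := sum_hilbertKernel_le n.natAbs (N + 1)
  calc _ ≤ 2 * (9 / √((n.natAbs : ℝ) + 1)) := by gcongr
    _ = _ := by ring

theorem norm_integral_exp_I_mul_le_of_abs {a b lam : ℝ} (hab : a ≤ b) (hlam : 0 < lam)
    {f f' f'' : ℝ → ℝ} (hf : ContinuousOn f (Set.Icc a b)) (hf' : ContinuousOn f' (Set.Icc a b))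
    (hf'' : ContinuousOn f'' (Set.Icc a b))
    (hd : ∀ x ∈ Set.Ioo a b, HasDerivAt f (f' x) x)
    (hd' : ∀ x ∈ Set.Ioo a b, HasDerivAt f' (f'' x) x)
    (hlow : ∀ x ∈ Set.Icc a b, lam ≤ |f'' x|) :
    ‖∫ x in a..b, Complex.exp (Complex.I * f x)‖ ≤ 8 / √lam := by
  have hsign : (∀ x ∈ Set.Icc a b, lam ≤ f'' x) ∨ ∀ x ∈ Set.Icc a b, lam ≤ -f'' x := by
    by_contra! h
    obtain ⟨⟨x, hx, hx'⟩, y, hy, hy'⟩ := h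
    have h1 : f'' x ≤ 0 := by
      by_contra! h
      exact absurd (hlow x hx) (by rw [abs_of_pos h]; linarith)
    have h2 : 0 ≤ f'' y := by
      by_contra! h
      exact absurd (hlow y hy) (by rw [abs_of_neg h]; linarith)
    obtain ⟨z, hz, hz'⟩ := isPreconnected_Icc.intermediate_value hx hy hf'' ⟨h1, h2⟩
    have := hlow z hz
    rw [hz', abs_zero] at this
    linarith
  rcases hsign with h | h
  · exact norm_integral_exp_I_mul_le hab hlam hf hf' hf'' hd hd' h
  · have key := norm_integral_exp_I_mul_le hab hlam hf.neg hf'.neg hf''.neg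
      (fun x hx => (hd x hx).neg) (fun x hx => (hd' x hx).neg) h
    have e : ∀ x, Complex.exp (Complex.I * ((-f) x : ℝ)) =
        (starRingEnd ℂ) (Complex.exp (Complex.I * f x)) := by
      intro x
      rw [← Complex.exp_conj]
      simp
    simp only [e] at key
    rwa [intervalIntegral.intervalIntegral_conj, RCLike.norm_conj] at key

theorem e_mul_conj_e (s t : ℝ) :
    e s * (starRingEnd ℂ) (e t) = Complex.exp (Complex.I * (2 * Real.pi * (s - t) : ℝ)) := by
  unfold e
  rw [← Complex.exp_conj, ← Complex.exp_add]
  congr 1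
  simp only [map_mul, Complex.conj_ofReal, Complex.conj_I, map_ofNat]
  push_cast
  ring

theorem continuous_e : Continuous e := by
  unfold e
  fun_prop

theorem norm_integral_e_mul_conj_e_le {φ : ℝ → ℝ} {ε : ℝ}
    (hφ : ContDiffOn ℝ 2 φ (Set.Icc (-1) 1)) (hε : 0 < ε)
    (hcurv : ∀ x ∈ Set.Icc (-1 : ℝ) 1, ε ≤ |iteratedDerivWithin 2 φ (Set.Icc (-1) 1) x|)
    (n m : ℤ) :
    ‖∫ x in (-1 : ℝ)..1, e (n * x + n ^ 2 * φ x) * (starRingEnd ℂ) (e (m * x + m ^ 2 * φ x))‖ ≤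
      (2 + 8 / √ε) * hilbertKernel n.natAbs m.natAbs := by
  simp only [e_mul_conj_e]
  have hεs : 0 < 8 / √ε := by positivity
  unfold hilbertKernel
  split_ifs with hnm
  · have := intervalIntegral.norm_integral_le_of_norm_le_const (a := (-1 : ℝ)) (b := 1) (C := 1)
      (f := fun x => Complex.exp (Complex.I *
        (2 * Real.pi * (n * x + n ^ 2 * φ x - (m * x + m ^ 2 * φ x)) : ℝ)))
      fun x _ => by rw [mul_comm, Complex.norm_exp_ofReal_mul_I]
    refine this.trans ?_
    rw [show |(1 : ℝ) - -1| = 2 by norm_num]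
    linarith
  · set j := n.natAbs
    set k := m.natAbs
    have hu : UniqueDiffOn ℝ (Set.Icc (-1 : ℝ) 1) := uniqueDiffOn_Icc (by norm_num)
    have hφ' : ContinuousOn (iteratedDerivWithin 1 φ (Set.Icc (-1) 1)) (Set.Icc (-1) 1) :=
      hφ.continuousOn_iteratedDerivWithin (by norm_num) hu
    have hφ'' : ContinuousOn (iteratedDerivWithin 2 φ (Set.Icc (-1) 1)) (Set.Icc (-1) 1) :=
      hφ.continuousOn_iteratedDerivWithin le_rfl hu
    have hd : ∀ x ∈ Set.Ioo (-1 : ℝ) 1,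
        HasDerivAt φ (iteratedDerivWithin 1 φ (Set.Icc (-1) 1) x) x := by
      intro x hx
      rw [iteratedDerivWithin_one]
      exact ((hφ.differentiableOn (by norm_num)) x
        (Set.Ioo_subset_Icc_self hx)).hasDerivWithinAt.hasDerivAt (Icc_mem_nhds hx.1 hx.2)
    have hd' : ∀ x ∈ Set.Ioo (-1 : ℝ) 1,
        HasDerivAt (iteratedDerivWithin 1 φ (Set.Icc (-1) 1))
          (iteratedDerivWithin 2 φ (Set.Icc (-1) 1) x) x := by
      intro x hx
      rw [show iteratedDerivWithin 2 φ (Set.Icc (-1) 1) = _ from iteratedDerivWithin_succ (n := 1)]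
      exact ((hφ.differentiableOn_iteratedDerivWithin (m := 1) (by norm_num) hu) x
        (Set.Ioo_subset_Icc_self hx)).hasDerivWithinAt.hasDerivAt (Icc_mem_nhds hx.1 hx.2)
    have hX : 0 < |(j : ℝ) - k| * (max (j : ℝ) k + 1) := by
      have : (j : ℝ) - k ≠ 0 := sub_ne_zero.2 (by exact_mod_cast hnm)
      positivity
    have hdiff : |(j : ℝ) - k| * (max (j : ℝ) k + 1) ≤ 2 * |(n : ℝ) ^ 2 - m ^ 2| := by
      have hj : (j : ℝ) ^ 2 = (n : ℝ) ^ 2 := by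
        rw [Nat.cast_natAbs, Int.cast_abs, sq_abs]
      have hk : (k : ℝ) ^ 2 = (m : ℝ) ^ 2 := by
        rw [Nat.cast_natAbs, Int.cast_abs, sq_abs]
      have h1 : max j k + 1 ≤ 2 * (j + k) := by omega
      have h2 : max (j : ℝ) k + 1 ≤ 2 * (j + k) := by exact_mod_cast h1
      rw [← hj, ← hk, sq_sub_sq, abs_mul, abs_of_nonneg (by positivity : (0 : ℝ) ≤ j + k)]
      nlinarith [mul_le_mul_of_nonneg_left h2 (abs_nonneg ((j : ℝ) - k))]
    have key := norm_integral_exp_I_mul_le_of_abs (a := -1) (b := 1)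
      (lam := ε * (|(j : ℝ) - k| * (max (j : ℝ) k + 1))) (by norm_num) (by positivity)
      (f := fun x => 2 * Real.pi * (n * x + n ^ 2 * φ x - (m * x + m ^ 2 * φ x)))
      (f' := fun x => 2 * Real.pi * (n * 1 + n ^ 2 * iteratedDerivWithin 1 φ (Set.Icc (-1) 1) x -
        (m * 1 + m ^ 2 * iteratedDerivWithin 1 φ (Set.Icc (-1) 1) x)))
      (f'' := fun x => 2 * Real.pi * (n ^ 2 * iteratedDerivWithin 2 φ (Set.Icc (-1) 1) x -
        m ^ 2 * iteratedDerivWithin 2 φ (Set.Icc (-1) 1) x))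
      (by have := hφ.continuousOn; fun_prop) (by fun_prop) (by fun_prop)
      (fun x hx => ((((hasDerivAt_id x).const_mul (n : ℝ)).add ((hd x hx).const_mul _)).sub
        (((hasDerivAt_id x).const_mul (m : ℝ)).add ((hd x hx).const_mul _))).const_mul _)
      (fun x hx => ((((hd' x hx).const_mul _).const_add _).sub
        (((hd' x hx).const_mul _).const_add _)).const_mul _)
      (fun x hx => by
        rw [← sub_mul, abs_mul, abs_of_pos Real.two_pi_pos, abs_mul]
        have h1 : 2 * |(n : ℝ) ^ 2 - m ^ 2| ≤ 2 * Real.pi * |(n : ℝ) ^ 2 - m ^ 2| := by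
          gcongr
          linarith [Real.pi_gt_three]
        calc _ ≤ |iteratedDerivWithin 2 φ (Set.Icc (-1) 1) x| *
              (2 * Real.pi * |(n : ℝ) ^ 2 - m ^ 2|) :=
            mul_le_mul (hcurv x hx) (hdiff.trans h1) hX.le (abs_nonneg _)
          _ = _ := by ring)
    refine key.trans ?_
    rw [Real.sqrt_mul hε.le, ← div_div, div_eq_mul_one_div (8 / √ε)]
    gcongr
    linarith

theorem integral_norm_sq_exponential_sum_le {φ : ℝ → ℝ} {ε : ℝ}
    (hφ : ContDiffOn ℝ 2 φ (Set.Icc (-1) 1)) (hε : 0 < ε)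
    (hcurv : ∀ x ∈ Set.Icc (-1 : ℝ) 1, ε ≤ |iteratedDerivWithin 2 φ (Set.Icc (-1) 1) x|)
    (N : ℕ) (a : ℤ → ℂ) :
    ∫ x in (-1 : ℝ)..1,
      ‖∑ n ∈ Finset.Icc (-(N : ℤ)) N, a n * e (n * x + n ^ 2 * φ x)‖ ^ 2 ≤
      18 * (2 + 8 / √ε) * ∑ n ∈ Finset.Icc (-(N : ℤ)) N, ‖a n‖ ^ 2 := by
  set s := Finset.Icc (-(N : ℤ)) N
  set J : ℤ → ℤ → ℝ → ℂ := fun n m x =>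
    e (n * x + n ^ 2 * φ x) * (starRingEnd ℂ) (e (m * x + m ^ 2 * φ x)) with hJ
  have hφc := hφ.continuousOn
  have hec : ∀ n : ℤ, ContinuousOn (fun x => e (n * x + n ^ 2 * φ x)) (Set.Icc (-1) 1) :=
    fun n => continuous_e.comp_continuousOn (by fun_prop)
  have hJi : ∀ n m, IntervalIntegrable (fun x => a n * (starRingEnd ℂ) (a m) * J n m x)
      volume (-1) 1 := fun n m =>
    (continuousOn_const.mul ((hec n).mul
      (Complex.continuous_conj.comp_continuousOn (hec m)))).intervalIntegrable_of_Icc (by norm_num)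
  have hexp : ∀ x, ((‖∑ n ∈ s, a n * e (n * x + n ^ 2 * φ x)‖ ^ 2 : ℝ) : ℂ) =
      ∑ n ∈ s, ∑ m ∈ s, a n * (starRingEnd ℂ) (a m) * J n m x := by
    intro x
    rw [Complex.ofReal_pow, ← Complex.mul_conj', map_sum, Finset.sum_mul_sum]
    refine Finset.sum_congr rfl fun n _ => Finset.sum_congr rfl fun m _ => ?_
    rw [map_mul, hJ]
    ring
  have hint : ((∫ x in (-1 : ℝ)..1, ‖∑ n ∈ s, a n * e (n * x + n ^ 2 * φ x)‖ ^ 2 : ℝ) : ℂ) =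
      ∑ n ∈ s, ∑ m ∈ s, a n * (starRingEnd ℂ) (a m) * ∫ x in (-1 : ℝ)..1, J n m x := by
    rw [← intervalIntegral.integral_ofReal]
    simp only [hexp]
    rw [intervalIntegral.integral_finsetSum fun n _ => by
      simpa only [Finset.sum_fn] using IntervalIntegrable.sum s fun m _ => hJi n m]
    refine Finset.sum_congr rfl fun n _ => ?_
    rw [intervalIntegral.integral_finsetSum fun m _ => hJi n m]
    exact Finset.sum_congr rfl fun m _ => intervalIntegral.integral_const_mul _ _
  refine (Complex.norm_real _ ▸ Real.le_norm_self _ : _ ≤ ‖((_ : ℝ) : ℂ)‖).trans ?_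
  rw [hint]
  calc _ ≤ ∑ n ∈ s, ∑ m ∈ s,
        (2 + 8 / √ε) * (hilbertKernel n.natAbs m.natAbs * (‖a n‖ * ‖a m‖)) := by
        refine norm_sum_le_of_le _ fun n _ => norm_sum_le_of_le _ fun m _ => ?_
        rw [norm_mul, norm_mul, RCLike.norm_conj]
        calc _ ≤ ‖a n‖ * ‖a m‖ * ((2 + 8 / √ε) * hilbertKernel n.natAbs m.natAbs) := by
              gcongr
              exact norm_integral_e_mul_conj_e_le hφ hε hcurv n m
          _ = _ := by ring
    _ ≤ (2 + 8 / √ε) * (18 * ∑ n ∈ s, ‖a n‖ ^ 2) := by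
        simp only [← Finset.mul_sum]
        gcongr
        exact sum_hilbertKernel_natAbs_mul_le N fun n => ‖a n‖
    _ = _ := by ring

/-- **Theorem (Demeter–Langowski).** If `φ : [-1,1] → ℝ` is `C²` with
`inf_{x ∈ [-1,1]} |φ''(x)| > 0`, then there is `C > 0` depending only on `φ` such that for
every `N ≥ 1` and all complex coefficients `(a_n)_{n=-N}^N`,
`‖∑_{n=-N}^N a_n e(nx + n²φ(x))‖_{L²(-1,1)} ≤ C (∑ |a_n|²)^{1/2}`. -/
theorem stmt0 (φ : ℝ → ℝ)
    (hφ : ContDiffOn ℝ 2 φ (Set.Icc (-1) 1))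
    (hcurv : ∃ ε > 0, ∀ x ∈ Set.Icc (-1:ℝ) 1,
      ε ≤ |iteratedDerivWithin 2 φ (Set.Icc (-1) 1) x|) :
    ∃ C > 0, ∀ N : ℕ, 0 < N → ∀ a : ℤ → ℂ,
      eLpNorm (fun x : ℝ =>
          ∑ n ∈ Finset.Icc (-(N:ℤ)) (N:ℤ), a n * e ((n:ℝ) * x + (n:ℝ)^2 * φ x)) 2
        (volume.restrict (Set.Ioo (-1) 1))
      ≤ ENNReal.ofReal
          (C * Real.sqrt (∑ n ∈ Finset.Icc (-(N:ℤ)) (N:ℤ), ‖a n‖^2)) := by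
  obtain ⟨ε, hε, hcurv⟩ := hcurv
  refine ⟨√(18 * (2 + 8 / √ε)), by positivity, fun N _ a => ?_⟩
  have hφc := hφ.continuousOn
  have hFc : ContinuousOn (fun x : ℝ =>
      ∑ n ∈ Finset.Icc (-(N : ℤ)) N, a n * e ((n : ℝ) * x + (n : ℝ) ^ 2 * φ x))
      (Set.Icc (-1) 1) :=
    continuousOn_finsetSum _ fun n _ =>
      continuousOn_const.mul (continuous_e.comp_continuousOn (by fun_prop))
  have hmem : MemLp (fun x : ℝ =>
      ∑ n ∈ Finset.Icc (-(N : ℤ)) N, a n * e ((n : ℝ) * x + (n : ℝ) ^ 2 * φ x)) 2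
      (volume.restrict (Set.Ioo (-1) 1)) := by
    rw [memLp_two_iff_integrable_sq_norm
      ((hFc.mono Set.Ioo_subset_Icc_self).aestronglyMeasurable measurableSet_Ioo)]
    exact ((hFc.norm.pow 2).integrableOn_Icc).mono_set Set.Ioo_subset_Icc_self
  rw [hmem.eLpNorm_eq_integral_rpow_norm two_ne_zero ENNReal.ofNat_ne_top]
  refine ENNReal.ofReal_le_ofReal ?_
  rw [← Real.sqrt_mul (by positivity), ENNReal.toReal_ofNat, ← one_div, ← Real.sqrt_eq_rpow]
  refine Real.sqrt_le_sqrt ?_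
  have := integral_norm_sq_exponential_sum_le hφ hε hcurv N a
  rw [intervalIntegral.integral_of_le (by norm_num), integral_Ioc_eq_integral_Ioo] at this
  simpa only [Real.rpow_two] using this
end

section
/- Fix an integer k ≥ 3. There exists a constant c > 0, depending only on k, such that for every positive integer N there is a sequence of complex numbers (a_n)_{n=-N}^{N}, not all zero, with ‖∑_{n=-N}^{N} a_n e(n x − n² x^k)‖_{L²(-1,1)} ≥ c N^{(k−2)/(6(k−1))} (∑_{n=-N}^{N} |a_n|²)^{1/2}. -/
open MeasureTheory

lemma e_add (x y : ℝ) : e (x + y) = e x * e y := by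
  simp only [e, ← Complex.exp_add]
  congr 1
  push_cast
  ring

lemma e_eq_exp_mul_I (x : ℝ) : e x = Complex.exp ((2 * Real.pi * x : ℝ) * Complex.I) := by
  simp only [e]
  congr 1
  push_cast
  ring

lemma norm_e (x : ℝ) : ‖e x‖ = 1 := by
  rw [e_eq_exp_mul_I, Complex.norm_exp_ofReal_mul_I]

lemma e_ne_zero (x : ℝ) : e x ≠ 0 := Complex.exp_ne_zero _

lemma half_le_re_e {x : ℝ} (h0 : 0 ≤ x) (h1 : x ≤ 1 / 6) : 1 / 2 ≤ (e x).re := by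
  rw [e_eq_exp_mul_I, Complex.exp_ofReal_mul_I_re, ← Real.cos_pi_div_three]
  have hpi := Real.pi_pos
  apply Real.cos_le_cos_of_nonneg_of_le_pi <;> nlinarith

/-- Phases that agree up to `1 / 6` modulo a common shift interfere constructively. -/
lemma card_div_two_le_norm_sum_e {ι : Type*} (S : Finset ι) (A : ℝ) (d : ι → ℝ)
    (h0 : ∀ i ∈ S, 0 ≤ d i) (h1 : ∀ i ∈ S, d i ≤ 1 / 6) :
    (S.card : ℝ) / 2 ≤ ‖∑ i ∈ S, e (A + d i)‖ := by
  simp only [e_add, ← Finset.mul_sum, norm_mul, norm_e, one_mul]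
  refine le_trans ?_ (Complex.re_le_norm _)
  rw [Complex.re_sum]
  calc (S.card : ℝ) / 2 = ∑ i ∈ S, (1 / 2 : ℝ) := by simp; ring
    _ ≤ _ := Finset.sum_le_sum fun i hi => half_le_re_e (h0 i hi) (h1 i hi)

lemma one_sub_pow_le {t : ℝ} (h0 : 0 ≤ t) (h1 : t ≤ 1) (k : ℕ) :
    (1 - t) ^ k ≤ 1 - k * t + (k : ℝ) ^ 2 * t ^ 2 := by
  induction k with
  | zero => simp
  | succ k ih =>
    have hk : (0 : ℝ) ≤ k := Nat.cast_nonneg k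
    have h := mul_le_mul_of_nonneg_right ih (sub_nonneg.2 h1)
    rw [pow_succ]
    push_cast
    have h3 : 0 ≤ (k : ℝ) ^ 2 * t ^ 3 := by positivity
    have h4 : 0 ≤ (k + 1 : ℝ) * t ^ 2 := by positivity
    nlinarith

/-- Near the critical point `s` of `x ↦ x - 2 N x ^ k`, the phase of frequency `N - u`, taken
relative to the phase of frequency `N`, varies little. -/
lemma phase_variation_bounds {k : ℕ} (hk : 1 ≤ k) {N s u t : ℝ} (hN : 0 < N) (hs : 0 < s)
    (hsk : 2 * k * N * s ^ k = s) (hu : 0 ≤ u) (h0 : 0 ≤ t) (h1 : t ≤ 1) :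
    0 ≤ -u * (s * (1 - t) - s) + (2 * N * u - u ^ 2) * ((s * (1 - t)) ^ k - s ^ k) ∧
      -u * (s * (1 - t) - s) + (2 * N * u - u ^ 2) * ((s * (1 - t)) ^ k - s ^ k) ≤
        k * (u * s * t ^ 2) + u ^ 2 * s * t / N / 2 := by
  have hk' : (0 : ℝ) < k := by exact_mod_cast hk
  have hP1 := one_sub_pow_le h0 h1 k
  have hP2 : 1 - k * t ≤ (1 - t) ^ k := by
    have := one_add_mul_le_pow (a := -t) (by linarith) k
    rw [← sub_eq_add_neg] at this
    linarith
  have hP3 : (1 - t) ^ k ≤ 1 := pow_le_one₀ (by linarith) (by linarith)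
  have hq : s ^ k = s / (2 * k * N) := by
    field_simp
    linarith
  rw [mul_pow, hq]
  set P := (1 - t) ^ k
  have key : -u * (s * (1 - t) - s) +
      (2 * N * u - u ^ 2) * (s / (2 * k * N) * P - s / (2 * k * N)) =
      u * s / k * (P - 1 + k * t) + u ^ 2 * s / (2 * k * N) * (1 - P) := by
    field_simp
    ring
  rw [key]
  constructor
  · have : 0 ≤ P - 1 + k * t := by linarith
    have : 0 ≤ 1 - P := by linarith
    positivity
  · have e1 : u * s / k * (P - 1 + k * t) ≤ u * s / k * ((k : ℝ) ^ 2 * t ^ 2) := by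
      gcongr
      linarith
    have e2 : u ^ 2 * s / (2 * k * N) * (1 - P) ≤ u ^ 2 * s / (2 * k * N) * (k * t) := by
      gcongr
      linarith
    have e3 : u * s / k * ((k : ℝ) ^ 2 * t ^ 2) = k * (u * s * t ^ 2) := by
      field_simp
    have e4 : u ^ 2 * s / (2 * k * N) * (k * t) = u ^ 2 * s * t / N / 2 := by
      field_simp
    linarith

lemma le_eLpNorm_two_of_le_norm_on_Ioo {f : ℝ → ℂ} {a b B : ℝ} (hB : 0 ≤ B) (hab : a < b)
    {s : Set ℝ} (hs : Set.Ioo a b ⊆ s) (h : ∀ x ∈ Set.Ioo a b, B ≤ ‖f x‖) :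
    ENNReal.ofReal (B * Real.sqrt (b - a)) ≤ eLpNorm f 2 (volume.restrict s) := by
  have h1 : eLpNorm (fun _ : ℝ => B) 2 (volume.restrict (Set.Ioo a b)) ≤
      eLpNorm f 2 (volume.restrict (Set.Ioo a b)) := by
    apply eLpNorm_mono_ae
    filter_upwards [ae_restrict_mem measurableSet_Ioo] with x hx
    rw [Real.norm_of_nonneg hB]
    exact h x hx
  refine le_trans (le_of_eq ?_) (h1.trans (eLpNorm_mono_measure _ (Measure.restrict_mono hs le_rfl)))
  rw [eLpNorm_const' _ (by norm_num) (by norm_num), Measure.restrict_apply_univ, Real.volume_Ioo,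
    ENNReal.ofReal_mul hB, Real.sqrt_eq_rpow, Real.enorm_eq_ofReal hB,
    ENNReal.ofReal_rpow_of_nonneg (by linarith) (by norm_num)]
  norm_num

/-- The critical point of `x ↦ x - 2 N x ^ k`, with its size. -/
lemma exists_critical_point {k : ℕ} (hk : 3 ≤ k) {N : ℝ} (hN : 1 ≤ N) :
    ∃ s : ℝ, 0 < s ∧ s < 1 ∧ 2 * k * N * s ^ k = s ∧
      s ≤ N ^ (-(1 / ((k : ℝ) - 1))) ∧ N ^ (-(1 / ((k : ℝ) - 1))) ≤ 2 * k * s := by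
  have hk' : (3 : ℝ) ≤ k := by exact_mod_cast hk
  set α : ℝ := 1 / ((k : ℝ) - 1) with hα
  have hα0 : 0 < α := by
    rw [hα]
    apply one_div_pos.2
    linarith
  have hα1 : α ≤ 1 := by
    rw [hα, div_le_one (by linarith)]
    linarith
  have hN0 : (0 : ℝ) < N := by linarith
  have h2k : (1 : ℝ) ≤ 2 * k := by linarith
  have hNα : 0 < N ^ (-α) := Real.rpow_pos_of_pos hN0 _
  refine ⟨(2 * k * N) ^ (-α), by positivity, ?_, ?_, ?_, ?_⟩
  · apply Real.rpow_lt_one_of_one_lt_of_neg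
    · nlinarith
    · linarith
  · rw [← Real.rpow_natCast, ← Real.rpow_mul (by positivity)]
    nth_rewrite 1 [← Real.rpow_one (2 * k * N)]
    rw [← Real.rpow_add (by positivity)]
    congr 1
    have : (k : ℝ) - 1 ≠ 0 := by linarith
    rw [hα]
    field_simp
    ring
  · rw [Real.mul_rpow (by positivity) hN0.le]
    have := Real.rpow_le_one_of_one_le_of_nonpos h2k (by linarith : -α ≤ 0)
    nlinarith
  · rw [Real.mul_rpow (by positivity) hN0.le, ← mul_assoc]
    have h : (1 : ℝ) ≤ 2 * k * (2 * k) ^ (-α) := by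
      nth_rewrite 1 [← Real.rpow_one (2 * (k : ℝ))]
      rw [← Real.rpow_add (by positivity)]
      exact Real.one_le_rpow h2k (by linarith)
    nlinarith

/-- **Theorem (lower bound in Theorem 2).** For `k ≥ 3` there is `c > 0` (depending only on
`k`) such that for every `N ≥ 1` there are coefficients `(a_n)_{n=-N}^N`, not all zero, with
`‖∑_{n=-N}^N a_n e(nx − n²xᵏ)‖_{L²(-1,1)} ≥ c N^{(k−2)/(6(k−1))} (∑ |a_n|²)^{1/2}`. -/
theorem stmt2 (k : ℕ) (hk : 3 ≤ k) :
    ∃ c > 0, ∀ N : ℕ, 0 < N → ∃ a : ℤ → ℂ,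
      (∃ n ∈ Finset.Icc (-(N:ℤ)) (N:ℤ), a n ≠ 0) ∧
      ENNReal.ofReal
          (c * (N:ℝ) ^ (((k:ℝ) - 2) / (6 * ((k:ℝ) - 1))) *
            Real.sqrt (∑ n ∈ Finset.Icc (-(N:ℤ)) (N:ℤ), ‖a n‖^2))
        ≤ eLpNorm (fun x : ℝ =>
            ∑ n ∈ Finset.Icc (-(N:ℤ)) (N:ℤ), a n * e ((n:ℝ) * x - (n:ℝ)^2 * x^k)) 2
          (volume.restrict (Set.Ioo (-1) 1)) := by
  have hk' : (3 : ℝ) ≤ k := by exact_mod_cast hk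
  refine ⟨1 / (6 * k), by positivity, fun N hN => ?_⟩
  have hN1 : (1 : ℝ) ≤ N := by exact_mod_cast hN
  have hN0 : (0 : ℝ) < N := by linarith
  obtain ⟨s, hs0, hs1, hsk, hsle, hles⟩ := exists_critical_point hk hN1
  set α : ℝ := 1 / ((k : ℝ) - 1) with hα
  have hk1 : (0 : ℝ) < k - 1 := by linarith
  have hα0 : 0 < α := one_div_pos.2 hk1
  have hα1 : α ≤ 1 := by
    rw [hα, div_le_one (by linarith)]
    linarith
  set σ : ℝ := (N : ℝ) ^ (-α) with hσ
  set L : ℝ := (N : ℝ) ^ ((2 + α) / 3) with hL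
  set R : ℝ := (N : ℝ) ^ (-((1 - α) / 3)) with hR
  set G : ℝ := (N : ℝ) ^ (((k:ℝ) - 2) / (6 * ((k:ℝ) - 1))) with hG
  have hσ0 : 0 < σ := Real.rpow_pos_of_pos hN0 _
  have hL0 : 0 < L := Real.rpow_pos_of_pos hN0 _
  have hR0 : 0 < R := Real.rpow_pos_of_pos hN0 _
  have hG0 : 0 < G := Real.rpow_pos_of_pos hN0 _
  have hR1 : R ≤ 1 := Real.rpow_le_one_of_one_le_of_nonpos hN1 (by linarith)
  have hLN : L ≤ N := by
    refine (Real.rpow_le_rpow_of_exponent_le hN1 ?_).trans_eq (Real.rpow_one _)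
    linarith
  have hLσR : L * σ * R ^ 2 = 1 := by
    refine Eq.trans ?_ (Real.rpow_zero (N : ℝ))
    rw [hL, hσ, hR, ← Real.rpow_natCast, ← Real.rpow_mul hN0.le, ← Real.rpow_add hN0,
      ← Real.rpow_add hN0]
    congr 1
    push_cast
    ring
  have hL2 : L ^ 2 * σ * R = N := by
    refine Eq.trans ?_ (Real.rpow_one (N : ℝ))
    rw [hL, hσ, hR, ← Real.rpow_natCast, ← Real.rpow_mul hN0.le, ← Real.rpow_add hN0,
      ← Real.rpow_add hN0]
    congr 1
    push_cast
    ring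
  have hG2 : G ^ 2 = L * σ * R := by
    rw [hL, hσ, hR, hG, ← Real.rpow_natCast, ← Real.rpow_mul hN0.le, ← Real.rpow_add hN0,
      ← Real.rpow_add hN0]
    congr 1
    rw [hα]
    push_cast
    field_simp
    ring
  set U : ℕ := ⌊L⌋₊ with hU
  have hUL : (U : ℝ) ≤ L := Nat.floor_le hL0.le
  have hLU : L ≤ U + 1 := (Nat.lt_floor_add_one L).le
  have hUN : U ≤ N := by exact_mod_cast hUL.trans hLN
  set T : ℝ := R / (4 * k) with hT
  have hT0 : 0 < T := by positivity
  have hT1 : T ≤ 1 := by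
    rw [hT, div_le_one (by positivity)]
    linarith
  set S : Finset ℤ := Finset.Icc ((N : ℤ) - U) N with hS
  have hsub : S ⊆ Finset.Icc (-(N : ℤ)) N := Finset.Icc_subset_Icc_left (by omega)
  have hcard : (S.card : ℝ) = U + 1 := by
    have : S.card = U + 1 := by
      rw [hS, Int.card_Icc]
      omega
    rw [this]
    push_cast
    ring
  refine ⟨fun n => if n ∈ S then e (-((n:ℝ) * s - (n:ℝ)^2 * s^k)) else 0,
    ⟨N, hsub ?_, ?_⟩, ?_⟩
  · rw [hS, Finset.mem_Icc]
    omega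
  · have : (N : ℤ) ∈ S := by
      rw [hS, Finset.mem_Icc]
      omega
    simp only [this, if_true]
    exact e_ne_zero _
  have hsum : ∑ n ∈ Finset.Icc (-(N:ℤ)) (N:ℤ),
      ‖(if n ∈ S then e (-((n:ℝ) * s - (n:ℝ)^2 * s^k)) else 0)‖ ^ 2 = (U : ℝ) + 1 := by
    rw [← Finset.sum_subset hsub]
    · rw [← hcard, Finset.sum_congr rfl (g := fun _ => (1 : ℝ))]
      · simp
      · intro n hn
        simp [hn, norm_e]
    · intro n _ hn
      simp [hn]
  have hbound : ∀ x ∈ Set.Ioo (s - s * T) s, ((U : ℝ) + 1) / 2 ≤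
      ‖∑ n ∈ Finset.Icc (-(N:ℤ)) (N:ℤ),
        (if n ∈ S then e (-((n:ℝ) * s - (n:ℝ)^2 * s^k)) else 0) *
          e ((n:ℝ) * x - (n:ℝ)^2 * x^k)‖ := by
    intro x hx
    obtain ⟨t, rfl⟩ : ∃ t, x = s * (1 - t) := ⟨1 - x / s, by field_simp; ring⟩
    have ht0 : 0 ≤ t := by
      by_contra! h
      nlinarith [hx.2]
    have htT : t ≤ T := by
      by_contra! h
      nlinarith [hx.1]
    have hterm : ∀ n ∈ S, 0 ≤ (N : ℝ) - n ∧ (N : ℝ) - n ≤ L := by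
      intro n hn
      rw [hS, Finset.mem_Icc] at hn
      have h1 : ((N : ℤ) - U : ℝ) ≤ n := by exact_mod_cast hn.1
      have h2 : (n : ℝ) ≤ N := by exact_mod_cast hn.2
      push_cast at h1
      constructor <;> linarith
    have hphase := card_div_two_le_norm_sum_e S
      ((N * (s * (1 - t) - s)) - (N : ℝ) ^ 2 * ((s * (1 - t)) ^ k - s ^ k))
      (fun n => -((N : ℝ) - n) * (s * (1 - t) - s) +
        (2 * N * ((N : ℝ) - n) - ((N : ℝ) - n) ^ 2) * ((s * (1 - t)) ^ k - s ^ k))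
      (fun n hn => (phase_variation_bounds (by omega) hN0 hs0 hsk (hterm n hn).1 ht0
        (htT.trans hT1)).1)
      (fun n hn => by
        obtain ⟨hu0, huL⟩ := hterm n hn
        refine (phase_variation_bounds (by omega) hN0 hs0 hsk hu0 ht0 (htT.trans hT1)).2.trans ?_
        calc k * (((N : ℝ) - n) * s * t ^ 2) + ((N : ℝ) - n) ^ 2 * s * t / N / 2
            ≤ k * (L * σ * T ^ 2) + L ^ 2 * σ * T / N / 2 := by gcongr
          _ = (L * σ * R ^ 2) / (16 * k) + (L ^ 2 * σ * R) / N / (8 * k) := by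
              rw [hT]
              field_simp
              ring
          _ = 3 / (16 * k) := by
              rw [hLσR, hL2]
              field_simp
              norm_num
          _ ≤ 1 / 6 := by
              rw [div_le_div_iff₀ (by positivity) (by norm_num)]
              linarith)
    rw [hcard] at hphase
    refine hphase.trans (le_of_eq ?_)
    rw [← Finset.sum_subset hsub]
    · congr 1
      refine Finset.sum_congr rfl fun n hn => ?_
      rw [if_pos hn, ← e_add]
      congr 1
      ring
    · intro n _ hn
      simp [hn]
  refine le_trans (ENNReal.ofReal_le_ofReal ?_)
    (le_eLpNorm_two_of_le_norm_on_Ioo (by positivity) ?_ ?_ hbound)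
  · rw [hsum, sub_sub_cancel]
    refine (sq_le_sq₀ (by positivity) (by positivity)).1 ?_
    rw [mul_pow, mul_pow, mul_pow, Real.sq_sqrt (by positivity), Real.sq_sqrt (by positivity), hG2]
    have hU0 : (0 : ℝ) < (U : ℝ) + 1 := by positivity
    calc (1 / (6 * k : ℝ)) ^ 2 * (L * σ * R) * ((U : ℝ) + 1)
        ≤ (1 / (6 * k : ℝ)) ^ 2 * (((U : ℝ) + 1) * (2 * k * s) * R) * ((U : ℝ) + 1) := by gcongr
      _ = (((U : ℝ) + 1) ^ 2 * s * R / k) / 18 := by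
          field_simp
          norm_num
      _ ≤ (((U : ℝ) + 1) ^ 2 * s * R / k) / 16 := by
          gcongr
          norm_num
      _ = (((U : ℝ) + 1) / 2) ^ 2 * (s * T) := by
          rw [hT]
          field_simp
          norm_num
  · nlinarith
  · exact Set.Ioo_subset_Ioo (by nlinarith) hs1.le
end

section
/- Fix an integer k ≥ 3. There exist C_k ∈ (0,1) and constants 0 < c ≤ C, all depending only on k, such that for every positive integer N, all integers n, m with C_k N ≤ n < m ≤ N, and every real x with C_k N ≤ x ≤ N, the function f(x) = ((k−1)/k) ( (x−n)/(x+n)^{1/(k−1)} − (x−m)/(x+m)^{1/(k−1)} ) satisfies c (m−n) N^{−(2k−1)/(k−1)} ≤ |f''(x)| ≤ C (m−n) N^{−(2k−1)/(k−1)}. -/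
open Filter Topology

lemma hasDerivAt_const_add_rpow (p n : ℝ) {y : ℝ} (hy : 0 < y + n) :
    HasDerivAt (fun y : ℝ => (y + n) ^ p) (p * (y + n) ^ (p - 1)) y := by
  simpa using ((hasDerivAt_id y).add_const n).rpow_const (p := p) (Or.inl hy.ne')

lemma eventually_add_pos {n y : ℝ} (hy : 0 < y + n) : ∀ᶠ z in 𝓝 y, 0 < z + n :=
  (continuous_id.add continuous_const).continuousAt.eventually (lt_mem_nhds hy)

lemma hasDerivAt_sub_div_rpow (a n : ℝ) {y : ℝ} (hy : 0 < y + n) :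
    HasDerivAt (fun y : ℝ => (y - n) / (y + n) ^ a)
      ((1 - a) * (y + n) ^ (-a) + 2 * n * a * (y + n) ^ (-a - 1)) y := by
  have h := (hasDerivAt_const_add_rpow (1 - a) n hy).sub
    ((hasDerivAt_const_add_rpow (-a) n hy).const_mul (2 * n))
  have h' := h.congr_of_eventuallyEq (f₁ := fun y : ℝ => (y - n) / (y + n) ^ a) (by
    filter_upwards [eventually_add_pos hy] with z hz
    simp only [Pi.sub_apply]
    rw [show 1 - a = 1 + -a by ring, Real.rpow_add hz, Real.rpow_one, Real.rpow_neg hz.le]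
    ring)
  refine h'.congr_deriv ?_
  rw [show 1 - a - 1 = -a by ring]
  ring

lemma hasDerivAt_deriv_sub_div_rpow (a n : ℝ) {y : ℝ} (hy : 0 < y + n) :
    HasDerivAt (fun y : ℝ => (1 - a) * (y + n) ^ (-a) + 2 * n * a * (y + n) ^ (-a - 1))
      (-a * ((y + n) ^ (-a - 2) * ((1 - a) * y + (3 + a) * n))) y := by
  have h := ((hasDerivAt_const_add_rpow (-a) n hy).const_mul (1 - a)).add
    ((hasDerivAt_const_add_rpow (-a - 1) n hy).const_mul (2 * n * a))
  refine h.congr_deriv ?_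
  rw [show -a - 1 - 1 = -a - 2 by ring, show -a - 1 = (-a - 2) + 1 by ring,
    Real.rpow_add hy, Real.rpow_one]
  ring

lemma deriv_deriv_sub_div_rpow_sub (b a n m : ℝ) {x : ℝ} (hn : 0 < x + n) (hm : 0 < x + m) :
    deriv (deriv fun y : ℝ => b * ((y - n) / (y + n) ^ a - (y - m) / (y + m) ^ a)) x =
      b * a * ((x + m) ^ (-a - 2) * ((1 - a) * x + (3 + a) * m)
        - (x + n) ^ (-a - 2) * ((1 - a) * x + (3 + a) * n)) := by
  have h := ((hasDerivAt_deriv_sub_div_rpow a n hn).sub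
    (hasDerivAt_deriv_sub_div_rpow a m hm)).const_mul b
  have h' := h.congr_of_eventuallyEq
    (f₁ := deriv fun y : ℝ => b * ((y - n) / (y + n) ^ a - (y - m) / (y + m) ^ a)) (by
    filter_upwards [eventually_add_pos hn, eventually_add_pos hm] with z hz hz'
    exact (((hasDerivAt_sub_div_rpow a n hz).sub
      (hasDerivAt_sub_div_rpow a m hz')).const_mul b).deriv)
  rw [h'.deriv]
  ring

lemma hasDerivAt_rpow_mul_linear (a x : ℝ) {t : ℝ} (ht : 0 < x + t) :
    HasDerivAt (fun t : ℝ => (x + t) ^ (-a - 2) * ((1 - a) * x + (3 + a) * t))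
      (-((1 + a) * (x + t) ^ (-a - 3) * ((3 + a) * t - (1 + a) * x))) t := by
  have h₁ : HasDerivAt (fun t : ℝ => (x + t) ^ (-a - 2))
      ((-a - 2) * (x + t) ^ (-a - 2 - 1)) t := by
    simpa only [add_comm x] using
      hasDerivAt_const_add_rpow (-a - 2) x (y := t) (by rwa [add_comm])
  have h₂ : HasDerivAt (fun t : ℝ => (1 - a) * x + (3 + a) * t) (3 + a) t := by
    simpa using ((hasDerivAt_id t).const_mul (3 + a)).const_add ((1 - a) * x)
  refine (h₁.mul h₂).congr_deriv ?_
  rw [show -a - 2 - 1 = -a - 3 by ring, show -a - 2 = (-a - 3) + 1 by ring,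
    Real.rpow_add ht, Real.rpow_one]
  ring

lemma rpow_mul_linear_bounds {a N x t : ℝ} (ha : 0 < a) (ha' : a ≤ 1 / 2) (hN : 0 < N)
    (hx : N / 2 ≤ x) (hx' : x ≤ N) (ht : N / 2 ≤ t) (ht' : t ≤ N) :
    2 ^ (-a - 3) / 4 * N ^ (-a - 2) ≤
        (1 + a) * (x + t) ^ (-a - 3) * ((3 + a) * t - (1 + a) * x) ∧
      (1 + a) * (x + t) ^ (-a - 3) * ((3 + a) * t - (1 + a) * x) ≤ 8 * N ^ (-a - 2) := by
  have hlow : (2 * N) ^ (-a - 3) ≤ (x + t) ^ (-a - 3) :=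
    Real.rpow_le_rpow_of_nonpos (by linarith) (by linarith) (by linarith)
  have hup : (x + t) ^ (-a - 3) ≤ N ^ (-a - 3) :=
    Real.rpow_le_rpow_of_nonpos hN (by linarith) (by linarith)
  have hpow : N ^ (-a - 2) = N ^ (-a - 3) * N := by
    rw [show -a - 2 = (-a - 3) + 1 by ring, Real.rpow_add hN, Real.rpow_one]
  rw [Real.mul_rpow (by norm_num) hN.le] at hlow
  have h₁ : N / 4 ≤ (3 + a) * t - (1 + a) * x := by nlinarith
  have h₂ : (3 + a) * t - (1 + a) * x ≤ 4 * N := by nlinarith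
  have hpos : 0 < N ^ (-a - 3) := Real.rpow_pos_of_pos hN _
  have hpos₂ : (0:ℝ) < 2 ^ (-a - 3) := Real.rpow_pos_of_pos two_pos _
  have hpos₃ : 0 < (x + t) ^ (-a - 3) := Real.rpow_pos_of_pos (by linarith) _
  rw [hpow]
  constructor
  · calc 2 ^ (-a - 3) / 4 * (N ^ (-a - 3) * N)
        = 1 * (2 ^ (-a - 3) * N ^ (-a - 3)) * (N / 4) := by ring
      _ ≤ _ := by gcongr; linarith
  · calc (1 + a) * (x + t) ^ (-a - 3) * ((3 + a) * t - (1 + a) * x)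
        ≤ 2 * N ^ (-a - 3) * (4 * N) := by
          gcongr
          · linarith
          · linarith
      _ = _ := by ring


/-- **Lemma 6.** For `k ≥ 3` there are `C_k ∈ (0,1)` and `0 < c ≤ C` (depending only on
`k`) such that for every `N ≥ 1`, all integers `C_k N ≤ n < m ≤ N`, and every real
`C_k N ≤ x ≤ N`, the function
`f(x) = ((k−1)/k)((x−n)/(x+n)^{1/(k−1)} − (x−m)/(x+m)^{1/(k−1)})` satisfies
`|f''(x)| ∼ (m−n) N^{−(2k−1)/(k−1)}`. -/
theorem stmt6 (k : ℕ) (hk : 3 ≤ k) :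
    ∃ Ck ∈ Set.Ioo (0:ℝ) 1, ∃ c C : ℝ, 0 < c ∧ c ≤ C ∧
    ∀ N : ℕ, 0 < N → ∀ n m : ℤ,
      Ck * N ≤ (n:ℝ) → n < m → (m:ℝ) ≤ N →
    ∀ x : ℝ, Ck * N ≤ x → x ≤ N →
      let f : ℝ → ℝ := fun y =>
        (((k:ℝ) - 1) / k) *
          ((y - (n:ℝ)) / (y + (n:ℝ)) ^ (1 / ((k:ℝ) - 1))
            - (y - (m:ℝ)) / (y + (m:ℝ)) ^ (1 / ((k:ℝ) - 1)))
      c * ((m:ℝ) - n) * (N:ℝ) ^ (-((2 * (k:ℝ) - 1) / ((k:ℝ) - 1)))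
          ≤ |deriv (deriv f) x| ∧
        |deriv (deriv f) x|
          ≤ C * ((m:ℝ) - n) * (N:ℝ) ^ (-((2 * (k:ℝ) - 1) / ((k:ℝ) - 1))) := by
  have hk' : (3:ℝ) ≤ k := by exact_mod_cast hk
  have hk₀ : (0:ℝ) < k := by linarith
  have hk₁ : (0:ℝ) < (k:ℝ) - 1 := by linarith
  have hexp : -((2 * (k:ℝ) - 1) / ((k:ℝ) - 1)) = -(1 / ((k:ℝ) - 1)) - 2 := by
    field_simp
    ring
  have hba : ((k:ℝ) - 1) / k * (1 / ((k:ℝ) - 1)) = 1 / k := by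
    field_simp
  have ha : 0 < 1 / ((k:ℝ) - 1) := by positivity
  have ha' : 1 / ((k:ℝ) - 1) ≤ 1 / 2 :=
    one_div_le_one_div_of_le two_pos (by linarith)
  rw [hexp]
  generalize 1 / ((k:ℝ) - 1) = a at *
  refine ⟨1 / 2, by norm_num, 1 / k * (2 ^ (-a - 3) / 4), 1 / k * 8, by positivity, ?_, ?_⟩
  · have : (2:ℝ) ^ (-a - 3) ≤ 1 :=
      Real.rpow_le_one_of_one_le_of_nonpos (by norm_num) (by linarith)
    gcongr
    linarith
  intro N hN n m hn hnm hm x hx hx'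
  have hN' : (0:ℝ) < N := by exact_mod_cast hN
  have hnm' : (n:ℝ) < m := by exact_mod_cast hnm
  dsimp only
  rw [deriv_deriv_sub_div_rpow_sub _ _ _ _ (by linarith) (by linarith), hba]
  have hderiv : ∀ t : ℝ, n ≤ t → HasDerivAt
      (fun t : ℝ => (x + t) ^ (-a - 2) * ((1 - a) * x + (3 + a) * t))
      (-((1 + a) * (x + t) ^ (-a - 3) * ((3 + a) * t - (1 + a) * x))) t := fun t ht =>
    hasDerivAt_rpow_mul_linear a x (by linarith)
  obtain ⟨t, ⟨hnt, htm⟩, ht⟩ := exists_hasDerivAt_eq_slope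
    (fun t : ℝ => (x + t) ^ (-a - 2) * ((1 - a) * x + (3 + a) * t)) _ hnm'
    (fun t ht => (hderiv t ht.1).continuousAt.continuousWithinAt)
    (fun t ht => hderiv t ht.1.le)
  obtain ⟨hlow, hup⟩ := rpow_mul_linear_bounds (t := t) ha ha' hN' (by linarith) hx'
    (by linarith) (by linarith)
  have hd : 0 < (m:ℝ) - n := sub_pos.2 hnm'
  rw [eq_div_iff hd.ne'] at ht
  rw [← ht]
  set D := (1 + a) * (x + t) ^ (-a - 3) * ((3 + a) * t - (1 + a) * x)
  have hD : 0 < D := lt_of_lt_of_le (by positivity) hlow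
  rw [show 1 / (k:ℝ) * (-D * ((m:ℝ) - n)) = -(1 / k * ((m:ℝ) - n) * D) by ring, abs_neg,
    abs_of_pos (by positivity)]
  constructor
  · calc _ = 1 / (k:ℝ) * ((m:ℝ) - n) * (2 ^ (-a - 3) / 4 * (N:ℝ) ^ (-a - 2)) := by ring
      _ ≤ _ := by gcongr
  · calc _ ≤ 1 / (k:ℝ) * ((m:ℝ) - n) * (8 * (N:ℝ) ^ (-a - 2)) := by gcongr
      _ = _ := by ring
end

section
/- Fix an integer k ≥ 3. There exist C_k ∈ (0,1), ε_k > 0 and constants 0 < c ≤ C, all depending only on k, such that for every positive integer N, all integers n, m with C_k N ≤ n < m ≤ N, and every real x with C_k N ≤ x ≤ N satisfying |x − n| ≤ ε_k (m−n) or |x − m| ≤ ε_k (m−n), the function f(x) = ((k−1)/k) ( (x−n)/(x+n)^{1/(k−1)} − (x−m)/(x+m)^{1/(k−1)} ) satisfies c (m−n)² N^{−(2k−1)/(k−1)} ≤ |f'(x)| ≤ C (m−n)² N^{−(2k−1)/(k−1)}. -/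
open Set

/-- The `y`-derivative of `(y - t) / (y + t) ^ a` at `y = x`, as a function of `t`. -/
noncomputable def quotientSlope (a x t : ℝ) : ℝ :=
  (x + t) ^ (-a - 1) * ((1 - a) * x + (1 + a) * t)

lemma hasDerivAt_sub_div_add_rpow (a : ℝ) {x t : ℝ} (h : 0 < x + t) :
    HasDerivAt (fun y : ℝ => (y - t) / (y + t) ^ a) (quotientSlope a x t) x := by
  have hpow : HasDerivAt (fun y : ℝ => (y + t) ^ (-a)) (1 * (-a) * (x + t) ^ (-a - 1)) x :=
    ((hasDerivAt_id x).add_const t).rpow_const (Or.inl h.ne')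
  have hmul := ((hasDerivAt_id x).sub_const t).mul hpow
  have hval : 1 * (x + t) ^ (-a) + (x - t) * (1 * (-a) * (x + t) ^ (-a - 1)) =
      quotientSlope a x t := by
    have hsplit : (x + t) ^ (-a) = (x + t) ^ (-a - 1) * (x + t) := by
      rw [← Real.rpow_add_one h.ne', sub_add_cancel]
    rw [hsplit, quotientSlope]
    ring
  refine (hval ▸ hmul).congr_of_eventuallyEq ?_
  have hpos : ∀ᶠ y in nhds x, 0 < y + t :=
    (continuous_id.add continuous_const).continuousAt.eventually (lt_mem_nhds h)
  filter_upwards [hpos] with y hy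
  simp [Real.rpow_neg hy.le, div_eq_mul_inv]

lemma hasDerivAt_quotientSlope (a : ℝ) {x t : ℝ} (h : 0 < x + t) :
    HasDerivAt (quotientSlope a x) (a * (1 + a) * ((x - t) * (x + t) ^ (-a - 2))) t := by
  have hpow : HasDerivAt (fun y : ℝ => (x + y) ^ (-a - 1))
      (1 * (-a - 1) * (x + t) ^ (-a - 1 - 1)) t :=
    ((hasDerivAt_id t).const_add x).rpow_const (Or.inl h.ne')
  have hmul := hpow.mul (((hasDerivAt_id t).const_mul (1 + a)).const_add ((1 - a) * x))
  have hsplit : (x + t) ^ (-a - 1) = (x + t) ^ (-a - 2) * (x + t) := by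
    rw [← Real.rpow_add_one h.ne']
    ring_nf
  refine hmul.congr_deriv ?_
  rw [show -a - 1 - 1 = -a - 2 by ring, hsplit]
  simp only [id]
  ring

lemma mul_sub_le_quotientSlope_sub {a x s t L : ℝ} (ha : 0 ≤ a) (hst : s ≤ t) (hs : 0 < x + s)
    (hL : ∀ u ∈ Icc s t, L ≤ (x - u) * (x + u) ^ (-a - 2)) :
    a * (1 + a) * L * (t - s) ≤ quotientSlope a x t - quotientSlope a x s := by
  have hd : ∀ u ∈ Icc s t, HasDerivAt (quotientSlope a x) _ u := fun u hu =>
    hasDerivAt_quotientSlope a (hs.trans_le (by linarith [hu.1]))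
  refine (convex_Icc s t).mul_sub_le_image_sub_of_le_deriv
    (fun u hu => (hd u hu).continuousAt.continuousWithinAt)
    (fun u hu => (hd u (interior_subset hu)).differentiableAt.differentiableWithinAt)
    (fun u hu => ?_) s (left_mem_Icc.2 hst) t (right_mem_Icc.2 hst) hst
  rw [(hd u (interior_subset hu)).deriv]
  exact mul_le_mul_of_nonneg_left (hL u (interior_subset hu)) (by positivity)

lemma quotientSlope_sub_le_mul_sub {a x s t U : ℝ} (ha : 0 ≤ a) (hst : s ≤ t) (hs : 0 < x + s)
    (hU : ∀ u ∈ Icc s t, (x - u) * (x + u) ^ (-a - 2) ≤ U) :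
    quotientSlope a x t - quotientSlope a x s ≤ a * (1 + a) * U * (t - s) := by
  have hd : ∀ u ∈ Icc s t, HasDerivAt (quotientSlope a x) _ u := fun u hu =>
    hasDerivAt_quotientSlope a (hs.trans_le (by linarith [hu.1]))
  refine (convex_Icc s t).image_sub_le_mul_sub_of_deriv_le
    (fun u hu => (hd u hu).continuousAt.continuousWithinAt)
    (fun u hu => (hd u (interior_subset hu)).differentiableAt.differentiableWithinAt)
    (fun u hu => ?_) s (left_mem_Icc.2 hst) t (right_mem_Icc.2 hst) hst
  rw [(hd u (interior_subset hu)).deriv]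
  exact mul_le_mul_of_nonneg_left (hU u (interior_subset hu)) (by positivity)

lemma rpow_mem_Icc_of_mem_Icc {a M y : ℝ} (ha : 0 ≤ a) (ha1 : a ≤ 1) (hM : 0 < M)
    (hy : y ∈ Icc M (2 * M)) :
    y ^ (-a - 2) ∈ Icc (M ^ (-a - 2) / 8) (M ^ (-a - 2)) := by
  have hneg : -a - 2 ≤ 0 := by linarith
  refine ⟨?_, Real.rpow_le_rpow_of_nonpos hM hy.1 hneg⟩
  have htwo : (1 / 8 : ℝ) ≤ 2 ^ (-a - 2) := by
    calc (1 / 8 : ℝ) = 2 ^ (-3 : ℝ) := by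
          rw [Real.rpow_neg (by norm_num)]; norm_num
      _ ≤ 2 ^ (-a - 2) := Real.rpow_le_rpow_of_exponent_le (by norm_num) (by linarith)
  calc M ^ (-a - 2) / 8 = 1 / 8 * M ^ (-a - 2) := by ring
    _ ≤ 2 ^ (-a - 2) * M ^ (-a - 2) := by gcongr
    _ = (2 * M) ^ (-a - 2) := (Real.mul_rpow (by norm_num) hM.le).symm
    _ ≤ y ^ (-a - 2) := Real.rpow_le_rpow_of_nonpos (hM.trans_le hy.1) hy.2 hneg

lemma abs_quotientSlope_sub_bounds {a M x p q : ℝ} (ha : 0 ≤ a) (ha1 : a ≤ 1) (hM : 0 < M)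
    (hp : M / 2 ≤ p) (hpq : p ≤ q) (hq : q ≤ M) (hx : M / 2 ≤ x) (hxM : x ≤ M)
    (hnear : |x - p| ≤ 1 / 100 * (q - p) ∨ |x - q| ≤ 1 / 100 * (q - p)) :
    a * (1 + a) * (q - p) ^ 2 * M ^ (-a - 2) / 50 ≤
        |quotientSlope a x p - quotientSlope a x q| ∧
      |quotientSlope a x p - quotientSlope a x q| ≤
        2 * (a * (1 + a)) * (q - p) ^ 2 * M ^ (-a - 2) := by
  set W := M ^ (-a - 2)
  have hWpos : 0 < W := Real.rpow_pos_of_pos hM _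
  have hw : ∀ u ∈ Icc p q, (x + u) ^ (-a - 2) ∈ Icc (W / 8) W := fun u hu =>
    rpow_mem_Icc_of_mem_Icc ha ha1 hM ⟨by linarith [hu.1], by linarith [hu.2]⟩
  set d := q - p with hd
  have hd0 : 0 ≤ d := sub_nonneg.2 hpq
  have hmid : p ≤ p + d / 2 ∧ p + d / 2 ≤ q := ⟨by linarith, by linarith⟩
  have hAW : 0 ≤ a * (1 + a) * d ^ 2 * W := by positivity
  have hxp : 0 < x + p := by linarith
  have hxmid : 0 < x + (p + d / 2) := by linarith
  have hmem₁ : ∀ u ∈ Icc p (p + d / 2), u ∈ Icc p q := fun u hu => ⟨hu.1, hu.2.trans hmid.2⟩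
  have hmem₂ : ∀ u ∈ Icc (p + d / 2) q, u ∈ Icc p q := fun u hu => ⟨hmid.1.trans hu.1, hu.2⟩
  have hdist : ∀ u ∈ Icc p q, -(2 * d) ≤ x - u ∧ x - u ≤ 2 * d := by
    intro u hu
    rcases hnear with h | h <;> have := abs_le.1 h <;> constructor <;> linarith [hu.1, hu.2]
  constructor
  · rcases hnear with h | h
    · obtain ⟨h1, h2⟩ := abs_le.1 h
      have hfirst := quotientSlope_sub_le_mul_sub (U := d / 100 * W) ha hmid.1 hxp
        fun u hu => by
          obtain ⟨hl, hr⟩ := hw u (hmem₁ u hu)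
          have : x - u ≤ d / 100 := by linarith [hu.1]
          nlinarith
      have hsecond := quotientSlope_sub_le_mul_sub (U := -(49 / 100 * d * (W / 8))) ha hmid.2 hxmid
        fun u hu => by
          obtain ⟨hl, hr⟩ := hw u (hmem₂ u hu)
          have : 49 / 100 * d ≤ u - x := by linarith [hu.1]
          nlinarith
      rw [show p + d / 2 - p = d / 2 by ring] at hfirst
      rw [show q - (p + d / 2) = d / 2 by rw [hd]; ring] at hsecond
      refine le_trans ?_ (le_abs_self _)
      nlinarith
    · obtain ⟨h1, h2⟩ := abs_le.1 h
      have hfirst := mul_sub_le_quotientSlope_sub (L := 49 / 100 * d * (W / 8)) ha hmid.1 hxp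
        fun u hu => by
          obtain ⟨hl, hr⟩ := hw u (hmem₁ u hu)
          have : 49 / 100 * d ≤ x - u := by linarith [hu.2]
          nlinarith
      have hsecond := mul_sub_le_quotientSlope_sub (L := -(d / 100 * W)) ha hmid.2 hxmid
        fun u hu => by
          obtain ⟨hl, hr⟩ := hw u (hmem₂ u hu)
          have : -(d / 100) ≤ x - u := by linarith [hu.2]
          nlinarith
      rw [show p + d / 2 - p = d / 2 by ring] at hfirst
      rw [show q - (p + d / 2) = d / 2 by rw [hd]; ring] at hsecond
      refine le_trans ?_ (neg_le_abs _)
      nlinarith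
  · have hupper := quotientSlope_sub_le_mul_sub (U := 2 * d * W) ha hpq hxp fun u hu => by
      obtain ⟨hl, hr⟩ := hw u hu
      have := (hdist u hu).2
      nlinarith
    have hlower := mul_sub_le_quotientSlope_sub (L := -(2 * d * W)) ha hpq hxp fun u hu => by
      obtain ⟨hl, hr⟩ := hw u hu
      have := (hdist u hu).1
      nlinarith
    rw [← hd] at hupper hlower
    rw [abs_le]
    constructor <;> nlinarith


/-- **Lemma 7.** For `k ≥ 3` there are `C_k ∈ (0,1)`, `ε_k > 0` and `0 < c ≤ C` (depending
only on `k`) such that for every `N ≥ 1`, all integers `C_k N ≤ n < m ≤ N`, and every real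
`C_k N ≤ x ≤ N` with `|x−n| ≤ ε_k(m−n)` or `|x−m| ≤ ε_k(m−n)`, the function
`f(x) = ((k−1)/k)((x−n)/(x+n)^{1/(k−1)} − (x−m)/(x+m)^{1/(k−1)})` satisfies
`|f'(x)| ∼ (m−n)² N^{−(2k−1)/(k−1)}`. -/
theorem stmt7 (k : ℕ) (hk : 3 ≤ k) :
    ∃ Ck ∈ Set.Ioo (0:ℝ) 1, ∃ εk > (0:ℝ), ∃ c C : ℝ, 0 < c ∧ c ≤ C ∧
    ∀ N : ℕ, 0 < N → ∀ n m : ℤ,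
      Ck * N ≤ (n:ℝ) → n < m → (m:ℝ) ≤ N →
    ∀ x : ℝ, Ck * N ≤ x → x ≤ N →
      (|x - (n:ℝ)| ≤ εk * ((m:ℝ) - n) ∨ |x - (m:ℝ)| ≤ εk * ((m:ℝ) - n)) →
      let f : ℝ → ℝ := fun y =>
        (((k:ℝ) - 1) / k) *
          ((y - (n:ℝ)) / (y + (n:ℝ)) ^ (1 / ((k:ℝ) - 1))
            - (y - (m:ℝ)) / (y + (m:ℝ)) ^ (1 / ((k:ℝ) - 1)))
      c * ((m:ℝ) - n)^2 * (N:ℝ) ^ (-((2 * (k:ℝ) - 1) / ((k:ℝ) - 1)))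
          ≤ |deriv f x| ∧
        |deriv f x|
          ≤ C * ((m:ℝ) - n)^2 * (N:ℝ) ^ (-((2 * (k:ℝ) - 1) / ((k:ℝ) - 1))) := by
  have hk' : (3 : ℝ) ≤ k := by exact_mod_cast hk
  set a : ℝ := 1 / ((k : ℝ) - 1) with ha_def
  have ha : 0 < a := by rw [ha_def]; exact one_div_pos.2 (by linarith)
  have ha1 : a ≤ 1 := by rw [ha_def]; exact (div_le_one (by linarith)).2 (by linarith)
  set K : ℝ := ((k : ℝ) - 1) / k with hK_def
  have hK : 0 < K := div_pos (by linarith) (by linarith)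
  have hexp : -((2 * (k : ℝ) - 1) / ((k : ℝ) - 1)) = -a - 2 := by
    have : (k : ℝ) - 1 ≠ 0 := by linarith
    rw [ha_def]
    field_simp
    ring
  have hKa : 0 < K * (a * (1 + a)) := by positivity
  refine ⟨1 / 2, ⟨by norm_num, by norm_num⟩, 1 / 100, by norm_num, K * (a * (1 + a)) / 50,
    2 * (K * (a * (1 + a))), by positivity, by linarith, ?_⟩
  intro N hN n m hn hnm hm x hx hxN hnear f
  have hN' : (0 : ℝ) < N := by exact_mod_cast hN
  have hnm' : (n : ℝ) < m := by exact_mod_cast hnm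
  have hderiv : deriv f x = K * (quotientSlope a x n - quotientSlope a x m) :=
    (((hasDerivAt_sub_div_add_rpow a (by linarith)).sub
      (hasDerivAt_sub_div_add_rpow a (by linarith))).const_mul K).deriv
  obtain ⟨hl, hu⟩ := abs_quotientSlope_sub_bounds ha.le ha1 hN' (by linarith) hnm'.le hm
    (by linarith) hxN hnear
  rw [hderiv, abs_mul, abs_of_pos hK, hexp]
  constructor
  · exact le_of_eq_of_le (by ring) (mul_le_mul_of_nonneg_left hl hK.le)
  · exact (mul_le_mul_of_nonneg_left hu hK.le).trans_eq (by ring)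
end
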